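/- arXiv:1310.6273 — 4 statements merged into one kernel-verified Lean document; each statement's English description precedes it below -/
import Mathlib

section
/- Discrete Karamata theorem: Let δ : ℕ → ℝ be a sequence with δ_j > 0 for all j and δ_j → +∞, such that the series Σ_j 1/(δ_j + 1) converges. Let a be a real number with 0 < a < 1 and let α ≥ 0. If Σ_j 1/(δ_j + t) = α·t^(a-1) + o(t^(a-1)) as t → +∞, then the counting function N(λ) = #{j ∈ ℕ : δ_j ≤ λ} satisfies N(λ) = α·(sin(πa)/(πa))·λ^a + o(λ^a) as λ → +∞. -/
open Filter Asymptotics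
open MeasureTheory Set Topology
open scoped NNReal

lemma integral_rpow_div_one_add_Ioi {a : ℝ} (ha0 : 0 < a) (ha1 : a < 1) :
    ∫ u in Ioi (0 : ℝ), u ^ (a - 1) / (1 + u) = Real.pi / Real.sin (Real.pi * a) := by
  have hbeta : ∫ x in Ioo (0 : ℝ) 1, x ^ (-a) * (1 - x) ^ (a - 1)
      = Real.pi / Real.sin (Real.pi * a) := by
    have hreflect : Real.pi / Real.sin (Real.pi * a) = ProbabilityTheory.beta (1 - a) a := by
      rw [ProbabilityTheory.beta, sub_add_cancel, Real.Gamma_one, div_one,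
        mul_comm (Real.Gamma _), Real.Gamma_mul_Gamma_one_sub]
    rw [hreflect, ProbabilityTheory.beta_eq_betaIntegralReal _ _ (sub_pos.2 ha1) ha0, Complex.betaIntegral,
      intervalIntegral.integral_of_le zero_le_one, ← integral_Ioc_eq_integral_Ioo,
      ← Complex.ofReal_re (∫ x in Ioc (0 : ℝ) 1, _), ← integral_complex_ofReal]
    congr 1
    refine setIntegral_congr_fun measurableSet_Ioc fun x hx => ?_
    simp only [Complex.ofReal_mul]
    rw [Complex.ofReal_cpow hx.1.le, Complex.ofReal_cpow (sub_nonneg.2 hx.2)]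
    push_cast
    ring_nf
  have himage : (fun u : ℝ => (1 + u)⁻¹) '' Ioi 0 = Ioo 0 1 := by
    ext x
    constructor
    · rintro ⟨u, hu, rfl⟩
      have hu : 0 < u := hu
      exact ⟨by positivity, inv_lt_one_of_one_lt₀ (by linarith)⟩
    · rintro ⟨h0, h1⟩
      exact ⟨x⁻¹ - 1, sub_pos.2 ((one_lt_inv₀ h0).2 h1), by simp⟩
  have hderiv : ∀ u ∈ Ioi (0 : ℝ),
      HasDerivWithinAt (fun u : ℝ => (1 + u)⁻¹) (-1 / (1 + u) ^ 2) (Ioi 0) u := by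
    intro u hu
    have hu : 0 < u := hu
    exact (((hasDerivAt_id u).const_add 1).inv (by positivity)).hasDerivWithinAt
  have hinj : InjOn (fun u : ℝ => (1 + u)⁻¹) (Ioi 0) := fun u _ v _ huv => by
    simpa using huv
  rw [← hbeta, ← himage, integral_image_eq_integral_abs_deriv_smul measurableSet_Ioi hderiv hinj]
  refine setIntegral_congr_fun measurableSet_Ioi fun u hu => ?_
  have hu : 0 < u := hu
  have h1 : 0 < 1 + u := by positivity
  have h2 : 1 - (1 + u)⁻¹ = u / (1 + u) := by field_simp; ring
  simp only [smul_eq_mul]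
  rw [h2, Real.inv_rpow h1.le, Real.rpow_neg h1.le, inv_inv, Real.div_rpow hu.le h1.le,
    Real.rpow_sub_one h1.ne', abs_div, abs_neg, abs_one, abs_of_pos (by positivity)]
  have := (Real.rpow_pos_of_pos h1 a).ne'
  field_simp

lemma integrableOn_rpow_div_one_add_Ioi {a : ℝ} (ha0 : 0 < a) (ha1 : a < 1) :
    IntegrableOn (fun u : ℝ => u ^ (a - 1) / (1 + u)) (Ioi 0) := by
  refine Integrable.of_integral_ne_zero ?_
  rw [integral_rpow_div_one_add_Ioi ha0 ha1]
  have : 0 < Real.sin (Real.pi * a) :=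
    Real.sin_pos_of_pos_of_lt_pi (by positivity) (by nlinarith [Real.pi_pos])
  positivity

lemma integral_rpow_div_add_Ioi {a c : ℝ} (ha0 : 0 < a) (ha1 : a < 1) (hc : 0 < c) :
    ∫ u in Ioi (0 : ℝ), u ^ (a - 1) / (c + u)
      = c ^ (a - 1) * (Real.pi / Real.sin (Real.pi * a)) := by
  have h := integral_comp_mul_left_Ioi' (fun u : ℝ => u ^ (a - 1) / (c + u)) 0 hc
  rw [mul_zero] at h
  rw [← h, ← integral_rpow_div_one_add_Ioi ha0 ha1, smul_eq_mul, ← integral_const_mul,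
    ← integral_const_mul]
  refine setIntegral_congr_fun measurableSet_Ioi fun u hu => ?_
  have hu : 0 < u := hu
  rw [Real.mul_rpow hc.le hu.le]
  field_simp

/-- The function `x ↦ 1 / (1 + c x)` on the unit interval. -/
noncomputable def unitResolvent (c : ℝ≥0) : C(unitInterval, ℝ) where
  toFun x := (1 + c * (x : ℝ))⁻¹
  continuous_toFun := by
    refine Continuous.inv₀ (by fun_prop) fun x => ?_
    have := x.2.1
    positivity

/-- The inclusion of the unit interval in the real line. -/
def unitCoe : C(unitInterval, ℝ) := ⟨Subtype.val, continuous_subtype_val⟩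

lemma norm_unitResolvent_le (c : ℝ≥0) : ‖unitResolvent c‖ ≤ 1 :=
  (ContinuousMap.norm_le _ zero_le_one).2 fun x => by
    have := x.2.1
    have h : 0 ≤ c * (x : ℝ) := by positivity
    change ‖(1 + c * (x : ℝ))⁻¹‖ ≤ 1
    rw [Real.norm_eq_abs, abs_of_nonneg (by positivity)]
    exact inv_le_one_of_one_le₀ (by linarith)

lemma unitResolvent_eq (c : ℝ≥0) :
    unitResolvent c = 1 - (c : ℝ) • (unitCoe * unitResolvent c) := by
  ext x
  have := x.2.1
  have h : 0 < 1 + c * (x : ℝ) := by positivity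
  change (1 + c * (x : ℝ))⁻¹ = 1 - c * (x * (1 + c * (x : ℝ))⁻¹)
  field_simp
  ring

/-- A closed subspace of `C([0,1])` containing every `1 / (1 + c x)` is everything. -/
lemma eq_top_of_unitResolvent_mem (S : Submodule ℝ C(unitInterval, ℝ))
    (hS : IsClosed (S : Set C(unitInterval, ℝ))) (h : ∀ c, unitResolvent c ∈ S) : S = ⊤ := by
  have key : ∀ n : ℕ, unitCoe ^ n ∈ S ∧
      ∀ c : ℝ≥0, c ≠ 0 → unitCoe ^ n * unitResolvent c ∈ S := by
    have lim : ∀ n : ℕ, (∀ c : ℝ≥0, c ≠ 0 → unitCoe ^ n * unitResolvent c ∈ S) →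
        unitCoe ^ n ∈ S := by
      intro n hn
      have ht : Tendsto (fun c : ℝ≥0 => unitCoe ^ n * unitResolvent c) (𝓝[≠] 0)
          (𝓝 (unitCoe ^ n)) := by
        rw [tendsto_iff_norm_sub_tendsto_zero]
        have h0 : Tendsto (fun c : ℝ≥0 => (c : ℝ) * ‖unitCoe ^ (n + 1)‖) (𝓝[≠] 0) (𝓝 0) := by
          have : Continuous fun c : ℝ≥0 => (c : ℝ) * ‖unitCoe ^ (n + 1)‖ := by fun_prop
          simpa using (this.tendsto 0).mono_left (nhdsWithin_le_nhds (s := {0}ᶜ))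
        refine squeeze_zero (fun _ => norm_nonneg _) (fun c => ?_) h0
        have heq : unitCoe ^ n * unitResolvent c - unitCoe ^ n
            = -((c : ℝ) • (unitCoe ^ (n + 1) * unitResolvent c)) := by
          conv_lhs => rw [unitResolvent_eq c]
          rw [mul_sub, mul_smul_comm, pow_succ, mul_assoc]
          simp
        rw [heq, norm_neg, norm_smul, NNReal.norm_eq]
        gcongr
        exact (norm_mul_le _ _).trans
          (mul_le_of_le_one_right (norm_nonneg _) (norm_unitResolvent_le c))
      refine hS.mem_of_tendsto ht ?_
      filter_upwards [self_mem_nhdsWithin] with c hc using hn c hc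
    intro n
    induction n with
    | zero => exact ⟨lim 0 fun c _ => by simpa using h c, fun c _ => by simpa using h c⟩
    | succ n ih =>
      have hres : ∀ c : ℝ≥0, c ≠ 0 → unitCoe ^ (n + 1) * unitResolvent c ∈ S := by
        intro c hc
        have heq : unitCoe ^ (n + 1) * unitResolvent c
            = (c : ℝ)⁻¹ • (unitCoe ^ n - unitCoe ^ n * unitResolvent c) := by
          conv_rhs => rw [unitResolvent_eq c]
          have hc' : (c : ℝ) ≠ 0 := by exact_mod_cast hc
          rw [mul_sub, mul_smul_comm, mul_one, sub_sub_cancel, smul_smul, inv_mul_cancel₀ hc',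
            one_smul, pow_succ, mul_assoc]
        rw [heq]
        exact S.smul_mem _ (S.sub_mem ih.1 (ih.2 c hc))
      exact ⟨lim _ hres, hres⟩
  have hpoly : ∀ p : Polynomial ℝ, p.toContinuousMapOn unitInterval ∈ S := by
    intro p
    induction p using Polynomial.induction_on' with
    | add p q hp hq =>
      have : (p + q).toContinuousMapOn unitInterval
          = p.toContinuousMapOn unitInterval + q.toContinuousMapOn unitInterval := by
        ext x; simp
      exact this ▸ S.add_mem hp hq
    | monomial n r =>
      have : (Polynomial.monomial n r).toContinuousMapOn unitInterval = r • unitCoe ^ n := by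
        ext x; simp [unitCoe]
      exact this ▸ S.smul_mem _ (key n).1
  rw [eq_top_iff]
  intro φ _
  have hφ : φ ∈ (polynomialFunctions unitInterval).topologicalClosure := by
    rw [polynomialFunctions_closure_eq_top']; trivial
  refine closure_minimal ?_ hS hφ
  rintro _ ⟨p, -, rfl⟩
  exact hpoly p

/-- Functionals on `C([0,1])` which are controlled by their value at `1` converge pointwise
as soon as they converge on every `1 / (1 + c x)`. -/
lemma tendsto_of_tendsto_unitResolvent {ι : Type*} {l : Filter ι}
    {F : ι → C(unitInterval, ℝ) →L[ℝ] ℝ} {G : C(unitInterval, ℝ) →L[ℝ] ℝ}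
    (hF : ∀ᶠ t in l, ∀ φ, ‖F t φ‖ ≤ F t 1 * ‖φ‖)
    (h : ∀ c, Tendsto (fun t => F t (unitResolvent c)) l (𝓝 (G (unitResolvent c))))
    (φ : C(unitInterval, ℝ)) : Tendsto (fun t => F t φ) l (𝓝 (G φ)) := by
  let S : Submodule ℝ C(unitInterval, ℝ) :=
    { carrier := {φ | Tendsto (fun t => F t φ) l (𝓝 (G φ))}
      add_mem' := fun {φ ψ} hφ hψ => by simpa using Tendsto.add hφ hψ
      zero_mem' := by simpa using tendsto_const_nhds
      smul_mem' := fun r φ hφ => by simpa using Tendsto.const_mul r hφ }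
  have h1 : Tendsto (fun t => F t 1) l (𝓝 (G 1)) := by
    have : unitResolvent 0 = 1 := by ext x; simp [unitResolvent]
    simpa [this] using h 0
  have hbound : ∀ᶠ t in l, ∀ φ, ‖F t φ‖ ≤ |G 1 + 1| * ‖φ‖ := by
    filter_upwards [hF, h1.eventually (eventually_le_nhds (lt_add_one (G 1)))] with t h1 h2 φ
    exact (h1 φ).trans (by gcongr; exact h2.trans (le_abs_self _))
  have hclosed : IsClosed (S : Set C(unitInterval, ℝ)) := by
    refine isClosed_of_closure_subset fun φ hφ => ?_
    change Tendsto (fun t => F t φ) l (𝓝 (G φ))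
    rw [Metric.tendsto_nhds]
    intro ε hε
    set K := |G 1 + 1| + ‖G‖ + 1 with hK
    have hKpos : 0 < K := by positivity
    obtain ⟨ψ, hψ, hdist⟩ := Metric.mem_closure_iff.1 hφ (ε / (2 * K)) (by positivity)
    rw [dist_eq_norm] at hdist
    filter_upwards [hbound, Metric.tendsto_nhds.1 hψ (ε / 2) (by positivity)] with t ht hψt
    rw [Real.dist_eq] at hψt ⊢
    have e1 : |F t (φ - ψ)| ≤ |G 1 + 1| * ‖φ - ψ‖ := ht _
    have e2 : |G (φ - ψ)| ≤ ‖G‖ * ‖φ - ψ‖ := G.le_opNorm _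
    have e3 : K * ‖φ - ψ‖ < ε / 2 := by
      calc K * ‖φ - ψ‖ < K * (ε / (2 * K)) := by gcongr
        _ = ε / 2 := by field_simp
    have e4 : F t φ - G φ = F t (φ - ψ) - G (φ - ψ) + (F t ψ - G ψ) := by
      simp only [map_sub]; ring
    have e5 := norm_nonneg (φ - ψ)
    rw [e4]
    calc _ ≤ |F t (φ - ψ)| + |G (φ - ψ)| + |F t ψ - G ψ| :=
          (abs_add_le _ _).trans (by gcongr; exact abs_sub _ _)
      _ < ε := by rw [hK] at e3; nlinarith
  have hS := eq_top_of_unitResolvent_mem S hclosed h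
  exact (hS ▸ Submodule.mem_top : φ ∈ S)

/-- The point `1 / (1 + u)` of the unit interval, for `0 ≤ u`. -/
noncomputable def unitPoint (u : ℝ) : unitInterval := projIcc 0 1 zero_le_one (1 + u)⁻¹

lemma continuous_unitPoint_comp_abs : Continuous fun u : ℝ => unitPoint |u| :=
  continuous_projIcc.comp
    (Continuous.inv₀ (by fun_prop) fun u => by positivity)

lemma coe_unitPoint {u : ℝ} (hu : 0 ≤ u) : (unitPoint u : ℝ) = (1 + u)⁻¹ := by
  have h : (1 + u)⁻¹ ∈ Icc (0 : ℝ) 1 := ⟨by positivity, inv_le_one_of_one_le₀ (by linarith)⟩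
  rw [unitPoint, projIcc_of_mem _ h]

lemma unitResolvent_unitPoint (c : ℝ≥0) {u : ℝ} (hu : 0 ≤ u) :
    (1 + u)⁻¹ * unitResolvent c (unitPoint u) = (1 + c + u)⁻¹ := by
  change (1 + u)⁻¹ * (1 + c * (unitPoint u : ℝ))⁻¹ = _
  have : 0 < 1 + u := by positivity
  rw [coe_unitPoint hu, ← mul_inv]
  congr 1
  field_simp
  ring

lemma exists_bump {b b' : ℝ} (hb : 0 < b) (hbb : b < b') :
    ∃ φ : C(unitInterval, ℝ), ∀ u, 0 ≤ u →
      (0 ≤ (1 + u)⁻¹ * φ (unitPoint u) ∧ (1 + u)⁻¹ * φ (unitPoint u) ≤ 1) ∧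
      (u ≤ b → (1 + u)⁻¹ * φ (unitPoint u) = 1) ∧
      (b' < u → (1 + u)⁻¹ * φ (unitPoint u) = 0) := by
  set p := (1 + b')⁻¹ with hp
  set q := (1 + b)⁻¹ with hq
  have hp0 : 0 < p := by have := hb.trans hbb; positivity
  have hpq : 0 < q - p := sub_pos.2 (inv_strictAnti₀ (by positivity) (by linarith))
  refine ⟨⟨fun x => max 0 (min 1 (((x : ℝ) - p) / (q - p))) / max (x : ℝ) p, ?_⟩, ?_⟩
  · exact Continuous.div (by fun_prop) (by fun_prop) fun x => (hp0.trans_le (le_max_right _ _)).ne'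
  intro u hu
  have hu1 : 0 < 1 + u := by positivity
  set x := (1 + u)⁻¹ with hx
  have hx0 : 0 < x := by positivity
  simp only [ContinuousMap.coe_mk, coe_unitPoint hu]
  rw [← hx]
  refine ⟨⟨?_, ?_⟩, fun h => ?_, fun h => ?_⟩
  · have : 0 < max x p := hp0.trans_le (le_max_right _ _)
    positivity
  · rw [← mul_div_assoc, div_le_one (hp0.trans_le (le_max_right _ _))]
    exact (mul_le_of_le_one_right hx0.le (max_le zero_le_one (min_le_left _ _))).trans
      (le_max_left _ _)
  · have hqx : q ≤ x := inv_anti₀ hu1 (by linarith)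
    rw [max_eq_left (by linarith : p ≤ x), min_eq_left, max_eq_right zero_le_one,
      mul_one_div_cancel hx0.ne']
    rw [le_div_iff₀ hpq]
    linarith
  · have hxp : x ≤ p := inv_anti₀ (by linarith) (by linarith)
    rw [max_eq_left, zero_div, mul_zero]
    exact (min_le_right _ _).trans (div_nonpos_of_nonpos_of_nonneg (by linarith) hpq.le)

lemma integrableOn_mul_unitPoint {w : ℝ → ℝ} (hw : IntegrableOn w (Ioi 0))
    (φ : C(unitInterval, ℝ)) : IntegrableOn (fun u => w u * φ (unitPoint u)) (Ioi 0) := by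
  have h : IntegrableOn (fun u => w u * φ (unitPoint |u|)) (Ioi 0) :=
    Integrable.mul_bdd (c := ‖φ‖) hw
      (φ.continuous.comp continuous_unitPoint_comp_abs).aestronglyMeasurable
      (ae_of_all _ fun u => φ.norm_coe_le_norm _)
  refine h.congr_fun (fun u hu => ?_) measurableSet_Ioi
  have hu : 0 < u := hu
  simp only [abs_of_pos hu]

/-- An integrable weight on the half-line defines a continuous functional on `C([0,1])`. -/
lemma exists_integral_functional {w : ℝ → ℝ} (hw : IntegrableOn w (Ioi 0)) :
    ∃ G : C(unitInterval, ℝ) →L[ℝ] ℝ, ∀ φ, G φ = ∫ u in Ioi 0, w u * φ (unitPoint u) := by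
  refine ⟨LinearMap.mkContinuous
    { toFun := fun φ => ∫ u in Ioi 0, w u * φ (unitPoint u)
      map_add' := fun φ ψ => ?_
      map_smul' := fun r φ => ?_ } (∫ u in Ioi 0, ‖w u‖) fun φ => ?_, fun φ => rfl⟩
  · rw [← integral_add (integrableOn_mul_unitPoint hw φ) (integrableOn_mul_unitPoint hw ψ)]
    simp [mul_add]
  · simp only [ContinuousMap.smul_apply, smul_eq_mul, RingHom.id_apply]
    rw [← integral_const_mul]
    congr with u
    ring
  · refine (norm_integral_le_integral_norm _).trans ?_
    rw [← integral_mul_const]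
    refine integral_mono (integrableOn_mul_unitPoint hw φ).norm (hw.norm.mul_const _) fun u => ?_
    simp only [norm_mul]
    gcongr
    exact φ.norm_coe_le_norm _

/-- The functional `φ ↦ ∑ w j * φ (x j)` on `C([0,1])`. -/
noncomputable def weightedEval (w : ℕ → ℝ) (x : ℕ → unitInterval) : C(unitInterval, ℝ) →L[ℝ] ℝ :=
  ∑' j, w j • ContinuousMap.evalCLM ℝ (x j)

section weightedEval

variable {w : ℕ → ℝ} (x : ℕ → unitInterval)

lemma norm_smul_evalCLM_le (hw : ∀ j, 0 ≤ w j) (j : ℕ) :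
    ‖w j • (ContinuousMap.evalCLM ℝ (x j) : C(unitInterval, ℝ) →L[ℝ] ℝ)‖ ≤ w j := by
  refine ContinuousLinearMap.opNorm_le_bound _ (hw j) fun φ => ?_
  change ‖w j * φ (x j)‖ ≤ _
  rw [norm_mul, Real.norm_of_nonneg (hw j)]
  exact mul_le_mul_of_nonneg_left (φ.norm_coe_le_norm _) (hw j)

lemma hasSum_weightedEval (hw : ∀ j, 0 ≤ w j) (hs : Summable w) (φ : C(unitInterval, ℝ)) :
    HasSum (fun j => w j * φ (x j)) (weightedEval w x φ) :=
  (Summable.of_norm_bounded hs (norm_smul_evalCLM_le x hw)).hasSum.mapL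
    (ContinuousLinearMap.apply ℝ ℝ φ)

lemma norm_weightedEval_le (hw : ∀ j, 0 ≤ w j) (hs : Summable w) (φ : C(unitInterval, ℝ)) :
    ‖weightedEval w x φ‖ ≤ weightedEval w x 1 * ‖φ‖ := by
  rw [← (hasSum_weightedEval x hw hs φ).tsum_eq]
  refine tsum_of_norm_bounded ((hasSum_weightedEval x hw hs 1).mul_right ‖φ‖) fun j => ?_
  rw [norm_mul, Real.norm_of_nonneg (hw j), ContinuousMap.one_apply, mul_one]
  exact mul_le_mul_of_nonneg_left (φ.norm_coe_le_norm _) (hw j)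

end weightedEval

lemma hasSum_indicator_natCard {s : Set ℕ} (hs : s.Finite) :
    HasSum (s.indicator fun _ => (1 : ℝ)) (Nat.card s) := by
  classical
  have h := hasSum_sum_of_ne_finset_zero (f := s.indicator fun _ => (1 : ℝ)) (s := hs.toFinset)
    (L := SummationFilter.unconditional ℕ)
    (fun j hj => indicator_of_notMem (by simpa using hj) _)
  convert h using 1
  rw [Finset.sum_congr rfl fun j hj => indicator_of_mem (hs.mem_toFinset.1 hj) _]
  simp [Nat.card_eq_card_finite_toFinset hs]

lemma integral_rpow_Ioc {a b : ℝ} (ha : 0 < a) (hb : 0 < b) :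
    ∫ u in Ioi (0 : ℝ), (Ioc 0 b).indicator (fun u => u ^ (a - 1)) u = b ^ a / a := by
  rw [setIntegral_indicator measurableSet_Ioc, inter_eq_right.2 Ioc_subset_Ioi_self,
    ← intervalIntegral.integral_of_le hb.le, integral_rpow (Or.inl (by linarith))]
  simp [ha.ne']

lemma integrableOn_rpow_Ioc {a b : ℝ} (ha : 0 < a) (hb : 0 < b) :
    IntegrableOn ((Ioc 0 b).indicator fun u : ℝ => u ^ (a - 1)) (Ioi 0) := by
  refine Integrable.integrableOn ?_
  rw [integrable_indicator_iff measurableSet_Ioc, ← intervalIntegrable_iff_integrableOn_Ioc_of_le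
    hb.le]
  exact intervalIntegral.intervalIntegrable_rpow' (by linarith)

lemma integral_bump_bounds {a b b' : ℝ} (ha0 : 0 < a) (ha1 : a < 1) (hb : 0 < b) (hbb : b < b')
    {φ : C(unitInterval, ℝ)} (hφ : ∀ u, 0 ≤ u →
      (0 ≤ (1 + u)⁻¹ * φ (unitPoint u) ∧ (1 + u)⁻¹ * φ (unitPoint u) ≤ 1) ∧
      (u ≤ b → (1 + u)⁻¹ * φ (unitPoint u) = 1) ∧
      (b' < u → (1 + u)⁻¹ * φ (unitPoint u) = 0)) :
    b ^ a / a ≤ ∫ u in Ioi 0, u ^ (a - 1) / (1 + u) * φ (unitPoint u) ∧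
      ∫ u in Ioi 0, u ^ (a - 1) / (1 + u) * φ (unitPoint u) ≤ b' ^ a / a := by
  have hφint := integrableOn_mul_unitPoint (integrableOn_rpow_div_one_add_Ioi ha0 ha1) φ
  have hb' := hb.trans hbb
  constructor
  · rw [← integral_rpow_Ioc ha0 hb]
    refine setIntegral_mono_on (integrableOn_rpow_Ioc ha0 hb) hφint measurableSet_Ioi fun u hu => ?_
    have hu : 0 < u := hu
    obtain ⟨⟨h0, -⟩, h1, -⟩ := hφ u hu.le
    rw [div_eq_mul_inv, mul_assoc]
    by_cases h : u ∈ Ioc 0 b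
    · rw [indicator_of_mem h, h1 h.2, mul_one]
    · rw [indicator_of_notMem h]
      positivity
  · rw [← integral_rpow_Ioc ha0 hb']
    refine setIntegral_mono_on hφint (integrableOn_rpow_Ioc ha0 hb') measurableSet_Ioi fun u hu => ?_
    have hu : 0 < u := hu
    obtain ⟨⟨-, h1⟩, -, h2⟩ := hφ u hu.le
    rw [div_eq_mul_inv, mul_assoc]
    rcases le_or_gt u b' with h | h
    · rw [indicator_of_mem (show u ∈ Ioc 0 b' from ⟨hu, h⟩)]
      exact mul_le_of_le_one_right (by positivity) h1
    · rw [indicator_of_notMem fun h' => absurd h'.2 h.not_ge, h2 h, mul_zero]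

lemma finite_setOf_le {δ : ℕ → ℝ} (htend : Tendsto δ atTop atTop) (l : ℝ) :
    {j : ℕ | δ j ≤ l}.Finite := by
  have h := (htend.eventually (eventually_gt_atTop l))
  rw [← Nat.cofinite_eq_atTop, eventually_cofinite] at h
  simpa using h

section Spectral

variable {δ : ℕ → ℝ} {t : ℝ}

lemma summable_one_div_add (hpos : ∀ j, 0 < δ j) (hsum : Summable fun j => 1 / (δ j + 1))
    (ht : 1 ≤ t) : Summable fun j => (1 + δ j / t)⁻¹ := by
  refine Summable.of_nonneg_of_le (fun j => ?_) (fun j => ?_) (hsum.mul_left t)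
  · have := hpos j
    positivity
  · have := hpos j
    rw [← div_eq_mul_one_div, inv_eq_one_div, div_le_div_iff₀ (by positivity) (by positivity)]
    field_simp
    nlinarith

/-- The rescaled functional `φ ↦ t⁻ᵃ ∑ x j * φ (x j)`, where `x j = t / (t + δ j)`. -/
noncomputable def rescaledEval (δ : ℕ → ℝ) (a t : ℝ) : C(unitInterval, ℝ) →L[ℝ] ℝ :=
  t ^ (-a) • weightedEval (fun j => (1 + δ j / t)⁻¹) fun j => unitPoint (δ j / t)

lemma hasSum_rescaledEval (hpos : ∀ j, 0 < δ j) (hsum : Summable fun j => 1 / (δ j + 1))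
    (a : ℝ) (ht : 1 ≤ t) (φ : C(unitInterval, ℝ)) :
    HasSum (fun j => t ^ (-a) * ((1 + δ j / t)⁻¹ * φ (unitPoint (δ j / t))))
      (rescaledEval δ a t φ) :=
  (hasSum_weightedEval _ (fun j => by have := hpos j; positivity)
    (summable_one_div_add hpos hsum ht) φ).mul_left _

lemma norm_rescaledEval_le (hpos : ∀ j, 0 < δ j) (hsum : Summable fun j => 1 / (δ j + 1))
    (a : ℝ) (ht : 1 ≤ t) (φ : C(unitInterval, ℝ)) :
    ‖rescaledEval δ a t φ‖ ≤ rescaledEval δ a t 1 * ‖φ‖ := by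
  have h : 0 ≤ t ^ (-a) := by positivity
  change ‖t ^ (-a) * weightedEval _ _ φ‖ ≤ t ^ (-a) * weightedEval _ _ 1 * ‖φ‖
  rw [norm_mul, Real.norm_of_nonneg h, mul_assoc]
  exact mul_le_mul_of_nonneg_left (norm_weightedEval_le _
    (fun j => by have := hpos j; positivity) (summable_one_div_add hpos hsum ht) φ) h

lemma rescaledEval_unitResolvent (hpos : ∀ j, 0 < δ j) (hsum : Summable fun j => 1 / (δ j + 1))
    (a : ℝ) (ht : 1 ≤ t) (c : ℝ≥0) :
    rescaledEval δ a t (unitResolvent c)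
      = (1 + c : ℝ) ^ (a - 1) *
        ((∑' j, 1 / (δ j + (1 + c) * t)) / ((1 + c) * t) ^ (a - 1)) := by
  have ht0 : 0 < t := by linarith
  have hc : (0 : ℝ) < 1 + c := by positivity
  rw [← (hasSum_rescaledEval hpos hsum a ht _).tsum_eq, Real.mul_rpow hc.le ht0.le, tsum_mul_left]
  have hterm : ∀ j, (1 + δ j / t)⁻¹ * unitResolvent c (unitPoint (δ j / t))
      = t * (1 / (δ j + (1 + c) * t)) := by
    intro j
    have := hpos j
    rw [unitResolvent_unitPoint c (by positivity)]
    field_simp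
    ring
  rw [tsum_congr hterm, tsum_mul_left, Real.rpow_neg ht0.le, Real.rpow_sub_one ht0.ne']
  have h1 := (Real.rpow_pos_of_pos hc (a - 1)).ne'
  have h2 := (Real.rpow_pos_of_pos ht0 a).ne'
  field_simp

lemma natCard_le_rescaledEval (hpos : ∀ j, 0 < δ j) (hsum : Summable fun j => 1 / (δ j + 1))
    (htend : Tendsto δ atTop atTop) (a : ℝ) (ht : 1 ≤ t) {φ : C(unitInterval, ℝ)}
    (h0 : ∀ u, 0 ≤ u → 0 ≤ (1 + u)⁻¹ * φ (unitPoint u))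
    (h1 : ∀ u, 0 ≤ u → u ≤ 1 → (1 + u)⁻¹ * φ (unitPoint u) = 1) :
    (Nat.card {j : ℕ | δ j ≤ t} : ℝ) / t ^ a ≤ rescaledEval δ a t φ := by
  have ht0 : 0 < t := by linarith
  rw [div_eq_inv_mul, ← Real.rpow_neg ht0.le]
  refine hasSum_le (fun j => ?_) ((hasSum_indicator_natCard (finite_setOf_le htend t)).mul_left _)
    (hasSum_rescaledEval hpos hsum a ht φ)
  have hu : 0 ≤ δ j / t := by have := hpos j; positivity
  refine mul_le_mul_of_nonneg_left ?_ (by positivity)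
  by_cases h : j ∈ {j : ℕ | δ j ≤ t}
  · rw [indicator_of_mem h, h1 _ hu ((div_le_one ht0).2 h)]
  · rw [indicator_of_notMem h]
    exact h0 _ hu

lemma rescaledEval_le_natCard (hpos : ∀ j, 0 < δ j) (hsum : Summable fun j => 1 / (δ j + 1))
    (htend : Tendsto δ atTop atTop) (a : ℝ) (ht : 1 ≤ t) {φ : C(unitInterval, ℝ)}
    (h0 : ∀ u, 0 ≤ u → (1 + u)⁻¹ * φ (unitPoint u) ≤ 1)
    (h1 : ∀ u, 1 < u → (1 + u)⁻¹ * φ (unitPoint u) = 0) :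
    rescaledEval δ a t φ ≤ (Nat.card {j : ℕ | δ j ≤ t} : ℝ) / t ^ a := by
  have ht0 : 0 < t := by linarith
  rw [div_eq_inv_mul, ← Real.rpow_neg ht0.le]
  refine hasSum_le (fun j => ?_) (hasSum_rescaledEval hpos hsum a ht φ)
    ((hasSum_indicator_natCard (finite_setOf_le htend t)).mul_left _)
  have hu : 0 ≤ δ j / t := by have := hpos j; positivity
  refine mul_le_mul_of_nonneg_left ?_ (by positivity)
  rcases le_or_gt (δ j) t with h | h
  · rw [indicator_of_mem (show j ∈ {j : ℕ | δ j ≤ t} from h)]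
    exact h0 _ hu
  · rw [indicator_of_notMem (show j ∉ {j : ℕ | δ j ≤ t} from h.not_ge),
      h1 _ ((one_lt_div ht0).2 h)]

end Spectral

/-- Discrete Karamata theorem: if `δ_j > 0`, `δ_j → +∞`, `Σ_j 1/(δ_j + 1) < ∞`,
`0 < a < 1`, `α ≥ 0`, and `Σ_j 1/(δ_j + t) = α·t^(a-1) + o(t^(a-1))` as `t → +∞`,
then `#{j : δ_j ≤ λ} = α·(sin(πa)/(πa))·λ^a + o(λ^a)` as `λ → +∞`. -/
theorem discrete_karamata (δ : ℕ → ℝ) (hpos : ∀ j, 0 < δ j)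
    (htend : Tendsto δ atTop atTop) (hsum : Summable fun j => 1 / (δ j + 1))
    (a α : ℝ) (ha0 : 0 < a) (ha1 : a < 1) (hα : 0 ≤ α)
    (h : (fun t : ℝ => (∑' j, 1 / (δ j + t)) - α * t ^ (a - 1))
      =o[atTop] fun t : ℝ => t ^ (a - 1)) :
    (fun l : ℝ =>
        (Nat.card {j : ℕ | δ j ≤ l} : ℝ) - α * (Real.sin (Real.pi * a) / (Real.pi * a)) * l ^ a)
      =o[atTop] fun l : ℝ => l ^ a := by
  have hsin : 0 < Real.sin (Real.pi * a) :=
    Real.sin_pos_of_pos_of_lt_pi (by positivity) (by nlinarith [Real.pi_pos])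
  have hS : Tendsto (fun t : ℝ => (∑' j, 1 / (δ j + t)) / t ^ (a - 1)) atTop (𝓝 α) := by
    have h' := h.tendsto_div_nhds_zero.add_const α
    rw [zero_add] at h'
    refine h'.congr' ?_
    filter_upwards [eventually_gt_atTop 0] with t ht
    have := (Real.rpow_pos_of_pos ht (a - 1)).ne'
    field_simp
    ring
  obtain ⟨G, hG⟩ := exists_integral_functional (integrableOn_rpow_div_one_add_Ioi ha0 ha1)
  set C : ℝ := α * (Real.sin (Real.pi * a) / Real.pi) with hC
  have hC0 : 0 ≤ C := by positivity
  have hlim : ∀ φ, Tendsto (fun t => rescaledEval δ a t φ) atTop (𝓝 (C * G φ)) := by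
    refine tendsto_of_tendsto_unitResolvent (G := C • G) ?_ fun c => ?_
    · filter_upwards [eventually_ge_atTop 1] with t ht using norm_rescaledEval_le hpos hsum a ht
    have hc : (0 : ℝ) < 1 + c := by positivity
    have hGc : (C • G) (unitResolvent c) = (1 + c : ℝ) ^ (a - 1) * α := by
      have : G (unitResolvent c)
          = (1 + c : ℝ) ^ (a - 1) * (Real.pi / Real.sin (Real.pi * a)) := by
        rw [hG, ← integral_rpow_div_add_Ioi ha0 ha1 hc]
        refine setIntegral_congr_fun measurableSet_Ioi fun u hu => ?_
        simp only [div_eq_mul_inv, mul_assoc]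
        rw [unitResolvent_unitPoint c (le_of_lt hu)]
      change C * G _ = _
      rw [this, hC]
      field_simp
    rw [hGc]
    refine ((hS.comp (tendsto_id.const_mul_atTop hc)).const_mul _).congr' ?_
    filter_upwards [eventually_ge_atTop 1] with t ht
    exact (rescaledEval_unitResolvent hpos hsum a ht c).symm
  have hcont : Tendsto (fun b : ℝ => C * (b ^ a / a)) (𝓝 1) (𝓝 (C / a)) := by
    have : ContinuousAt (fun b : ℝ => C * (b ^ a / a)) 1 :=
      ((Real.continuousAt_rpow_const _ _ (Or.inl one_ne_zero)).div_const a).const_mul C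
    simpa [ContinuousAt, div_eq_mul_inv] using this
  have hN : Tendsto (fun l : ℝ => (Nat.card {j : ℕ | δ j ≤ l} : ℝ) / l ^ a) atTop
      (𝓝 (C / a)) := by
    refine tendsto_order.2 ⟨fun y hy => ?_, fun y hy => ?_⟩
    · have hev := (hcont.mono_left (nhdsWithin_le_nhds (s := Iio 1))).eventually
        (eventually_gt_nhds hy)
      obtain ⟨b, hby, hb1, hb0⟩ := (hev.and (eventually_mem_nhdsWithin.and
        (eventually_nhdsWithin_of_eventually_nhds
          (eventually_gt_nhds (zero_lt_one' ℝ))))).exists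
      obtain ⟨φ, hφ⟩ := exists_bump hb0 hb1
      have hGφ : C * (b ^ a / a) ≤ C * G φ := by
        rw [hG]
        exact mul_le_mul_of_nonneg_left (integral_bump_bounds ha0 ha1 hb0 hb1 hφ).1 hC0
      filter_upwards [(hlim φ).eventually (eventually_gt_nhds (hby.trans_le hGφ)),
        eventually_ge_atTop 1] with t h1 ht
      exact h1.trans_le (rescaledEval_le_natCard hpos hsum htend a ht (fun u hu => (hφ u hu).1.2)
        fun u hu => (hφ u (zero_le_one.trans hu.le)).2.2 hu)
    · have hev := (hcont.mono_left (nhdsWithin_le_nhds (s := Ioi 1))).eventually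
        (eventually_lt_nhds hy)
      obtain ⟨b, hby, hb1⟩ := (hev.and eventually_mem_nhdsWithin).exists
      obtain ⟨φ, hφ⟩ := exists_bump one_pos hb1
      have hGφ : C * G φ ≤ C * (b ^ a / a) := by
        rw [hG]
        exact mul_le_mul_of_nonneg_left (integral_bump_bounds ha0 ha1 one_pos hb1 hφ).2 hC0
      filter_upwards [(hlim φ).eventually (eventually_lt_nhds (hGφ.trans_lt hby)),
        eventually_ge_atTop 1] with t h1 ht
      exact (natCard_le_rescaledEval hpos hsum htend a ht (fun u hu => (hφ u hu).1.1)
        fun u hu => (hφ u hu).2.1).trans_lt h1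
  have hne : ∀ᶠ l : ℝ in atTop, l ^ a ≠ 0 := by
    filter_upwards [eventually_gt_atTop 0] with l hl using (Real.rpow_pos_of_pos hl a).ne'
  rw [isLittleO_iff_tendsto' (hne.mono fun l hl h0 => absurd h0 hl)]
  have hN' := hN.sub_const (C / a)
  rw [sub_self] at hN'
  refine hN'.congr' ?_
  filter_upwards [hne] with l hl
  rw [hC]
  field_simp
end

section
/- Let n ≥ 1 and p be natural numbers with n < 2p, and let b > 0 be a real number. Then ∫_{ℝⁿ} (b^p·‖ξ‖^{2p} + 1)^{-1} dξ = (n/(2p))·b^{-n/2}·Vol(B₁)·π / sin(nπ/(2p)), where the integral is with respect to the Lebesgue measure on the n-dimensional Euclidean space. -/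
open MeasureTheory

open Set in
/-- Euler's integral of the first kind, in real form, at complementary parameters. -/
theorem integral_Ioo_rpow_mul_one_sub_rpow_neg {s : ℝ} (hs : 0 < s) (hs' : s < 1) :
    ∫ x in Ioo (0 : ℝ) 1, x ^ (s - 1) * (1 - x) ^ (-s) =
      Real.pi / Real.sin (Real.pi * s) := by
  have h := ProbabilityTheory.beta_eq_betaIntegralReal s (1 - s) hs (by linarith)
  rw [ProbabilityTheory.beta, add_sub_cancel, Real.Gamma_one, div_one,
    Real.Gamma_mul_Gamma_one_sub, Complex.betaIntegral,
    intervalIntegral.integral_of_le zero_le_one, integral_Ioc_eq_integral_Ioo] at h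
  have hcongr : ∫ x in Ioo (0 : ℝ) 1,
        (x : ℂ) ^ ((s : ℂ) - 1) * (1 - (x : ℂ)) ^ (((1 - s : ℝ) : ℂ) - 1) =
      ∫ x in Ioo (0 : ℝ) 1, ((x ^ (s - 1) * (1 - x) ^ (-s) : ℝ) : ℂ) := by
    refine setIntegral_congr_fun measurableSet_Ioo fun x hx => ?_
    have h1 : (0 : ℝ) ≤ 1 - x := by linarith [hx.2]
    simp only [Complex.ofReal_mul, Complex.ofReal_cpow hx.1.le, Complex.ofReal_cpow h1]
    push_cast
    ring_nf
  rw [hcongr, integral_complex_ofReal, Complex.ofReal_re] at h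
  exact h.symm

open Set in
theorem image_div_one_add_Ioi_zero :
    (fun x : ℝ => x / (1 + x)) '' Ioi 0 = Ioo 0 1 := by
  ext y
  constructor
  · rintro ⟨x, hx, rfl⟩
    have hx : 0 < x := hx
    exact ⟨by positivity, by rw [div_lt_one (by positivity)]; linarith⟩
  · rintro ⟨h0, h1⟩
    have h2 : 0 < 1 - y := by linarith
    refine ⟨y / (1 - y), div_pos h0 h2, ?_⟩
    field_simp
    ring

open Set in
/-- The Mellin transform of `x ↦ 1 / (1 + x)`. -/
theorem integral_Ioi_rpow_mul_inv_one_add {s : ℝ} (hs : 0 < s) (hs' : s < 1) :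
    ∫ x in Ioi (0 : ℝ), x ^ (s - 1) * (1 + x)⁻¹ = Real.pi / Real.sin (Real.pi * s) := by
  have hderiv : ∀ x ∈ Ioi (0 : ℝ),
      HasDerivWithinAt (fun x : ℝ => x / (1 + x)) (((1 + x) ^ 2)⁻¹) (Ioi 0) x := by
    intro x hx
    have hx : 0 < x := hx
    have h := (hasDerivAt_id x).div ((hasDerivAt_id x).const_add 1)
      (show (1 : ℝ) + id x ≠ 0 by simp only [id]; positivity)
    refine (h.congr_deriv ?_).hasDerivWithinAt
    simp only [id]
    field_simp
    ring
  have hinj : InjOn (fun x : ℝ => x / (1 + x)) (Ioi 0) := by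
    intro x hx y hy hxy
    have hx : 0 < x := hx
    have hy : 0 < y := hy
    have h : x / (1 + x) = y / (1 + y) := hxy
    field_simp at h
    linarith
  have h := integral_image_eq_integral_abs_deriv_smul measurableSet_Ioi hderiv hinj
    (fun x => x ^ (s - 1) * (1 - x) ^ (-s))
  rw [image_div_one_add_Ioi_zero, integral_Ioo_rpow_mul_one_sub_rpow_neg hs hs'] at h
  rw [h]
  refine setIntegral_congr_fun measurableSet_Ioi fun x hx => ?_
  have hx : 0 < x := hx
  have h1 : 0 < 1 + x := by positivity
  have h2 : 1 - x / (1 + x) = (1 + x)⁻¹ := by field_simp; ring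
  have h3 : (1 + x) ^ s = (1 + x) ^ (s - 1) * (1 + x) := by
    rw [← Real.rpow_add_one h1.ne', sub_add_cancel]
  have h4 : 0 < (1 + x) ^ (s - 1) := Real.rpow_pos_of_pos h1 _
  simp only [smul_eq_mul]
  rw [h2, abs_of_pos (by positivity), Real.div_rpow hx.le h1.le, Real.inv_rpow h1.le,
    Real.rpow_neg h1.le, inv_inv, h3]
  field_simp

open Set in
/-- The Mellin transform of `y ↦ 1 / (c * y ^ q + 1)`. -/
theorem integral_Ioi_rpow_mul_inv_mul_rpow_add_one {a q c : ℝ} (ha : 0 < a) (haq : a < q)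
    (hc : 0 < c) :
    ∫ y in Ioi (0 : ℝ), y ^ (a - 1) * (c * y ^ q + 1)⁻¹ =
      c ^ (-(a / q)) / q * (Real.pi / Real.sin (Real.pi * (a / q))) := by
  have hq : 0 < q := ha.trans haq
  have hscale := integral_comp_mul_left_Ioi (fun x : ℝ => x ^ (a / q - 1) * (1 + x)⁻¹) 0 hc
  rw [mul_zero, integral_Ioi_rpow_mul_inv_one_add (div_pos ha hq) ((div_lt_one hq).2 haq),
    ← integral_comp_rpow_Ioi_of_pos hq] at hscale
  have hcongr : ∫ y in Ioi (0 : ℝ), (q * y ^ (q - 1)) •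
        ((c * y ^ q) ^ (a / q - 1) * (1 + c * y ^ q)⁻¹) =
      ∫ y in Ioi (0 : ℝ), (q * c ^ (a / q - 1)) * (y ^ (a - 1) * (c * y ^ q + 1)⁻¹) := by
    refine setIntegral_congr_fun measurableSet_Ioi fun y hy => ?_
    have hy : 0 < y := hy
    have h : y ^ (a - 1) = y ^ (q - 1) * y ^ (q * (a / q - 1)) := by
      rw [← Real.rpow_add hy]
      congr 1
      field_simp
      ring
    simp only [smul_eq_mul]
    rw [Real.mul_rpow hc.le (by positivity), ← Real.rpow_mul hy.le, h, add_comm 1]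
    ring
  rw [hcongr, integral_const_mul, smul_eq_mul, Real.rpow_sub_one hc.ne'] at hscale
  have hpos : 0 < c ^ (a / q) := Real.rpow_pos_of_pos hc _
  rw [Real.rpow_neg hc.le]
  generalize Real.pi / Real.sin (Real.pi * (a / q)) = J at hscale ⊢
  field_simp at hscale ⊢
  linarith

/-- For `n < 2p` and `b > 0`,
`∫_{ℝⁿ} (b^p·‖ξ‖^{2p} + 1)⁻¹ dξ = (n/(2p))·b^{-n/2}·Vol(B₁)·π / sin(nπ/(2p))`. -/
theorem integral_inv_pow_norm (n p : ℕ) (hn : 1 ≤ n) (hnp : n < 2 * p)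
    (b : ℝ) (hb : 0 < b) :
    ∫ ξ : EuclideanSpace ℝ (Fin n), (b ^ p * ‖ξ‖ ^ (2 * p) + 1)⁻¹ =
      ((n : ℝ) / (2 * p)) * b ^ (-(n : ℝ) / 2) *
        (volume (Metric.ball (0 : EuclideanSpace ℝ (Fin n)) 1)).toReal *
        Real.pi / Real.sin ((n : ℝ) * Real.pi / (2 * p)) := by
  have : Nonempty (Fin n) := ⟨⟨0, hn⟩⟩
  have hp : (0 : ℝ) < p := by exact_mod_cast (by omega : 0 < p)
  rw [integral_fun_norm_addHaar volume (fun r : ℝ => (b ^ p * r ^ (2 * p) + 1)⁻¹),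
    finrank_euclideanSpace_fin]
  have hradial := integral_Ioi_rpow_mul_inv_mul_rpow_add_one (a := n) (q := 2 * p) (c := b ^ p)
    (by exact_mod_cast hn) (by exact_mod_cast hnp) (by positivity)
  have hexp : (b ^ p) ^ (-((n : ℝ) / (2 * p))) = b ^ (-(n : ℝ) / 2) := by
    rw [← Real.rpow_natCast b p, ← Real.rpow_mul hb.le]
    congr 1
    field_simp
  have hcongr : ∫ y in Set.Ioi (0 : ℝ), y ^ (n - 1) • (b ^ p * y ^ (2 * p) + 1)⁻¹ =
      ∫ y in Set.Ioi (0 : ℝ), y ^ ((n : ℝ) - 1) * (b ^ p * y ^ (2 * (p : ℝ)) + 1)⁻¹ := by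
    refine setIntegral_congr_fun measurableSet_Ioi fun y _ => ?_
    simp only [smul_eq_mul]
    rw [← Real.rpow_natCast y (n - 1), ← Real.rpow_natCast y (2 * p)]
    push_cast [Nat.cast_sub hn]
    rfl
  rw [hcongr, hradial, hexp, nsmul_eq_mul, smul_eq_mul, Measure.real,
    mul_comm (n : ℝ) Real.pi, mul_div_assoc Real.pi (n : ℝ)]
  ring
end

section
/- Let p ≥ 1 and n ≥ 1 be natural numbers with n < 2p, set a = n/(2p), and let A > 0 be real. Let δ, ν : ℕ → ℝ be sequences such that δ_j > 0 for all j, the series Σ_j 1/(δ_j^p + 1) converges, for every j and every real t > 0 the complex number (δ_j + iν_j)^p + t is nonzero, and for every ε > 0 one has |ν_j| ≤ ε·δ_j for all sufficiently large j. If Σ_j 1/((δ_j + iν_j)^p + t) = A·t^{a-1} + o(t^{a-1}) as t → +∞, then Σ_j 1/(δ_j^p + t) = A·t^{a-1} + o(t^{a-1}) as t → +∞. -/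
open Filter Asymptotics

/-- Points that are relatively close to positive reals `x j` stay relatively close after a shift. -/
theorem eventually_forall_norm_sub_le_mul_norm_add {z : ℕ → ℂ} {x : ℕ → ℝ} (hx : ∀ j, 0 < x j)
    (hz : ∀ ε > (0 : ℝ), ∀ᶠ j in atTop, ‖z j - x j‖ ≤ ε * x j) {c : ℝ} (hc : 0 < c) :
    ∀ᶠ t : ℝ in atTop, ∀ j, ‖z j - x j‖ ≤ c * ‖z j + t‖ := by
  set η : ℝ := min (c / 2) (1 / 2) with hη
  have hη0 : 0 < η := by positivity
  obtain ⟨N, hN⟩ := eventually_atTop.1 (hz η hη0)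
  have head : ∀ᶠ t : ℝ in atTop, ∀ j ∈ Finset.range N, ‖z j - x j‖ ≤ c * ‖z j + t‖ := by
    rw [eventually_all_finset]
    intro j _
    filter_upwards [eventually_ge_atTop (‖z j - x j‖ / c + ‖z j‖), eventually_ge_atTop 0]
      with t ht ht0
    have h1 : t - ‖z j‖ ≤ ‖z j + t‖ := by
      have := norm_sub_norm_le (t : ℂ) (-z j)
      rw [norm_neg, Complex.norm_of_nonneg ht0, sub_neg_eq_add, add_comm (t : ℂ)] at this
      exact this
    rw [mul_comm, ← div_le_iff₀ hc]
    linarith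
  filter_upwards [head, eventually_ge_atTop 0] with t ht ht0 j
  rcases lt_or_ge j N with hj | hj
  · exact ht j (Finset.mem_range.2 hj)
  · have h1 : x j + t - ‖z j - x j‖ ≤ ‖z j + t‖ := by
      have := norm_sub_norm_le ((x j + t : ℝ) : ℂ) (-(z j - x j))
      rw [norm_neg, Complex.norm_of_nonneg (by linarith [hx j])] at this
      refine this.trans (le_of_eq ?_)
      congr 1
      push_cast
      ring
    have h2 := hN j hj
    have h3 : η * x j ≤ c / 2 * x j := mul_le_mul_of_nonneg_right (min_le_left _ _) (hx j).le
    have h4 : η * x j ≤ 1 / 2 * x j := mul_le_mul_of_nonneg_right (min_le_right _ _) (hx j).le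
    have h5 : c * (1 / 2 * x j) ≤ c * ‖z j + t‖ :=
      mul_le_mul_of_nonneg_left (by linarith) hc.le
    linarith

/-- If `z j` is asymptotically relatively close to `x j > 0`, the resolvent sums of the two
sequences differ by a relatively small error. -/
theorem tsum_inv_add_sub_isLittleO {z : ℕ → ℂ} {x : ℕ → ℝ} (hx : ∀ j, 0 < x j)
    (hsum : Summable fun j => 1 / (x j + 1))
    (hz : ∀ ε > (0 : ℝ), ∀ᶠ j in atTop, ‖z j - x j‖ ≤ ε * x j) :
    (fun t : ℝ => (∑' j, (z j + t)⁻¹) - ((∑' j, 1 / (x j + t) : ℝ) : ℂ))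
      =o[atTop] fun t : ℝ => ((∑' j, 1 / (x j + t) : ℝ) : ℂ) := by
  rw [isLittleO_iff]
  intro c hc
  filter_upwards [eventually_forall_norm_sub_le_mul_norm_add hx hz hc, eventually_ge_atTop 1]
    with t ht ht1
  have hpos : ∀ j, 0 < x j + t := fun j => by linarith [hx j]
  have hsx : Summable fun j => 1 / (x j + t) :=
    hsum.of_nonneg_of_le (fun j => (one_div_pos.2 (hpos j)).le) fun j =>
      one_div_le_one_div_of_le (by linarith [hx j]) (by linarith)
  have hterm : ∀ j, ‖(z j + t)⁻¹ - ((1 / (x j + t) : ℝ) : ℂ)‖ ≤ c * (1 / (x j + t)) := by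
    intro j
    have hu : ((x j + t : ℝ) : ℂ) ≠ 0 := Complex.ofReal_ne_zero.2 (hpos j).ne'
    have hw : z j + t ≠ 0 := by
      intro h0
      have h1 := ht j
      rw [h0, norm_zero, mul_zero, norm_le_zero_iff, sub_eq_zero] at h1
      rw [h1] at h0
      exact hu (by exact_mod_cast h0)
    have hw' : 0 < ‖z j + t‖ := norm_pos_iff.2 hw
    rw [Complex.ofReal_div, Complex.ofReal_one, one_div, inv_sub_inv hw hu, norm_div, norm_mul,
      Complex.norm_of_nonneg (hpos j).le, mul_one_div, div_le_div_iff₀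
        (mul_pos hw' (hpos j)) (hpos j)]
    have h2 : ‖((x j + t : ℝ) : ℂ) - (z j + t)‖ = ‖z j - x j‖ := by
      rw [norm_sub_rev]
      congr 1
      push_cast
      ring
    rw [h2, ← mul_assoc]
    exact mul_le_mul_of_nonneg_right (ht j) (hpos j).le
  have hsd : Summable fun j => (z j + t)⁻¹ - ((1 / (x j + t) : ℝ) : ℂ) :=
    Summable.of_norm_bounded (hsx.mul_left c) hterm
  have hsxC : Summable fun j => ((1 / (x j + t) : ℝ) : ℂ) := Complex.summable_ofReal.2 hsx
  have hsz : Summable fun j => (z j + t)⁻¹ := by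
    simpa using hsd.add hsxC
  rw [Complex.norm_of_nonneg (tsum_nonneg fun j => (one_div_pos.2 (hpos j)).le),
    Complex.ofReal_tsum, ← hsz.tsum_sub hsxC, ← tsum_mul_left]
  exact tsum_of_norm_bounded (hsx.mul_left c).hasSum hterm

/-- Powers of `δ j + i ν j` are relatively close to powers of `δ j` when `ν = o(δ)`. -/
theorem eventually_norm_pow_sub_pow_le {δ ν : ℕ → ℝ} (p : ℕ) (hδ : ∀ j, 0 < δ j)
    (hν : ∀ ε > (0 : ℝ), ∀ᶠ j in atTop, |ν j| ≤ ε * δ j) {ε : ℝ} (hε : 0 < ε) :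
    ∀ᶠ j in atTop,
      ‖((δ j : ℂ) + ν j * Complex.I) ^ p - ((δ j ^ p : ℝ) : ℂ)‖ ≤ ε * δ j ^ p := by
  have hlim : Tendsto (fun j => ν j / δ j) atTop (nhds 0) := by
    have : ν =o[atTop] δ := isLittleO_iff.2 fun c hc => by
      filter_upwards [hν c hc] with j hj
      simpa [abs_of_pos (hδ j)] using hj
    exact this.tendsto_div_nhds_zero
  have hcont : Continuous fun r : ℝ => ‖(1 + (r : ℂ) * Complex.I) ^ p - 1‖ := by fun_prop
  have hlim' := (hcont.tendsto 0).comp hlim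
  simp only [Complex.ofReal_zero, zero_mul, add_zero, one_pow, sub_self, norm_zero] at hlim'
  filter_upwards [hlim'.eventually_le_const hε] with j hj
  have hδ0 : (δ j : ℂ) ≠ 0 := Complex.ofReal_ne_zero.2 (hδ j).ne'
  have hfac : ((δ j : ℂ) + ν j * Complex.I) ^ p - ((δ j ^ p : ℝ) : ℂ)
      = ((1 + ((ν j / δ j : ℝ) : ℂ) * Complex.I) ^ p - 1) * ((δ j ^ p : ℝ) : ℂ) := by
    rw [sub_mul, one_mul, Complex.ofReal_pow, ← mul_pow]
    congr 2
    push_cast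
    field_simp
  rw [hfac, norm_mul, Complex.norm_of_nonneg (pow_pos (hδ j) p).le]
  exact mul_le_mul_of_nonneg_right hj (pow_pos (hδ j) p).le

/-- If `Σ_j 1/((δ_j + iν_j)^p + t) = A·t^{a-1} + o(t^{a-1})` with `a = n/(2p)`, `δ_j > 0`,
`Σ_j 1/(δ_j^p + 1) < ∞`, and `|ν_j| ≤ ε·δ_j` for all large `j` (every `ε > 0`), then
`Σ_j 1/(δ_j^p + t) = A·t^{a-1} + o(t^{a-1})` as `t → +∞`. -/
theorem real_part_asymptotics (p n : ℕ) (hp : 1 ≤ p) (hn : 1 ≤ n) (hnp : n < 2 * p)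
    (a : ℝ) (ha : a = (n : ℝ) / (2 * p)) (A : ℝ) (hA : 0 < A)
    (δ ν : ℕ → ℝ) (hδ : ∀ j, 0 < δ j) (hsum : Summable fun j => 1 / (δ j ^ p + 1))
    (hne : ∀ j, ∀ t : ℝ, 0 < t → ((δ j : ℂ) + ν j * Complex.I) ^ p + t ≠ 0)
    (hν : ∀ ε > (0 : ℝ), ∀ᶠ j in atTop, |ν j| ≤ ε * δ j)
    (h : (fun t : ℝ =>
        (∑' j, (((δ j : ℂ) + ν j * Complex.I) ^ p + t)⁻¹) - ((A * t ^ (a - 1) : ℝ) : ℂ))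
      =o[atTop] fun t : ℝ => t ^ (a - 1)) :
    (fun t : ℝ => (∑' j, 1 / (δ j ^ p + t)) - A * t ^ (a - 1))
      =o[atTop] fun t : ℝ => t ^ (a - 1) := by
  have hdiff := tsum_inv_add_sub_isLittleO (fun j => pow_pos (hδ j) p) hsum
    fun ε hε => eventually_norm_pow_sub_pow_le p hδ hν hε
  have hmain : (fun t : ℝ => ((A * t ^ (a - 1) : ℝ) : ℂ)) =O[atTop] fun t : ℝ => t ^ (a - 1) :=
    IsBigO.of_bound |A| (Eventually.of_forall fun t => by
      rw [Complex.norm_real, norm_mul, Real.norm_eq_abs A])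
  have hS : (fun t : ℝ => ∑' j, (((δ j : ℂ) + ν j * Complex.I) ^ p + t)⁻¹)
      =O[atTop] fun t : ℝ => t ^ (a - 1) := by
    simpa using h.isBigO.add hmain
  have hR := hdiff.right_isBigO_add.trans (by simpa using hS)
  refine isLittleO_norm_left.1 (IsLittleO.congr_left (h.sub (hdiff.trans_isBigO hR)).norm_left ?_)
  intro t
  rw [← Complex.norm_real]
  congr 1
  push_cast
  ring
end

section
/- Let n ≥ 1 and p be natural numbers with n < 2p, let Ω be a measurable subset of ℝⁿ, and let a : ℝⁿ → ℝ be a measurable function with a(x) > 0 for all x ∈ Ω. Then, as an identity of extended nonnegative reals, ∫_Ω ∫_{ℝⁿ} [ (a(x)^p·‖ξ‖^{2p} + 1)^{-1} + (‖ξ‖^{2p} + 1)^{-1} ] dξ dx = (n·π / (2p·sin(nπ/(2p))))·Vol(B₁)·∫_Ω (a(x)^{-n/2} + 1) dx, where all integrals are with respect to Lebesgue measure. -/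
open MeasureTheory

open Module Set in
/-- The integral of `exp (-c‖ξ‖^m)` over a finite-dimensional normed space. -/
theorem lintegral_exp_neg_mul_norm_pow {E : Type*} [NormedAddCommGroup E] [NormedSpace ℝ E]
    [FiniteDimensional ℝ E] [Nontrivial E] [MeasurableSpace E] [BorelSpace E] (μ : Measure E)
    [μ.IsAddHaarMeasure] {m : ℕ} (hm : 0 < m) {c : ℝ} (hc : 0 < c) :
    ∫⁻ ξ, ENNReal.ofReal (Real.exp (-c * ‖ξ‖ ^ m)) ∂μ =
      ENNReal.ofReal (c ^ (-(finrank ℝ E : ℝ) / m) * Real.Gamma (finrank ℝ E / m + 1)) *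
        μ (Metric.ball 0 1) := by
  have hd : (0 : ℝ) < finrank ℝ E := Nat.cast_pos.mpr finrank_pos
  have hm' : (0 : ℝ) < m := Nat.cast_pos.mpr hm
  have hG : 0 < Real.Gamma (finrank ℝ E / m + 1) := Real.Gamma_pos_of_pos (by positivity)
  have hball : 0 < μ.real (Metric.ball (0 : E) 1) :=
    ENNReal.toReal_pos (Metric.measure_ball_pos μ 0 one_pos).ne' measure_ball_lt_top.ne
  have key : ∫ ξ, Real.exp (-c * ‖ξ‖ ^ m) ∂μ =
      c ^ (-(finrank ℝ E : ℝ) / m) * Real.Gamma (finrank ℝ E / m + 1) *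
        μ.real (Metric.ball 0 1) := by
    rw [integral_fun_norm_addHaar μ (fun r => Real.exp (-c * r ^ m))]
    simp_rw [← Real.rpow_natCast, smul_eq_mul, Nat.cast_sub (finrank_pos (R := ℝ) (M := E)),
      Nat.cast_one]
    rw [integral_rpow_mul_exp_neg_mul_rpow hm' (by linarith) hc, sub_add_cancel,
      Real.Gamma_add_one (by positivity), nsmul_eq_mul]
    ring
  have hint : Integrable (fun ξ => Real.exp (-c * ‖ξ‖ ^ m)) μ :=
    .of_integral_ne_zero (by rw [key]; positivity)
  rw [← ofReal_integral_eq_lintegral_ofReal hint (ae_of_all _ fun _ => (Real.exp_pos _).le), key,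
    ENNReal.ofReal_mul (by positivity), ofReal_measureReal measure_ball_lt_top.ne]

open Set in
/-- The integral representation `r⁻¹ = ∫₀^∞ exp (-rt) dt`. -/
theorem lintegral_exp_neg_mul_Ioi {r : ℝ} (hr : 0 < r) :
    ∫⁻ t in Ioi (0 : ℝ), ENNReal.ofReal (Real.exp (-r * t)) = ENNReal.ofReal r⁻¹ := by
  rw [← ofReal_integral_eq_lintegral_ofReal (integrableOn_exp_mul_Ioi (neg_lt_zero.mpr hr) 0)
    (ae_of_all _ fun _ => (Real.exp_pos _).le), integral_exp_mul_Ioi (neg_lt_zero.mpr hr)]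
  simp

open Set in
/-- Euler's integral for the Gamma function, with values in `ℝ≥0∞`. -/
theorem lintegral_exp_neg_mul_rpow_Ioi {s : ℝ} (hs : 0 < s) :
    ∫⁻ t in Ioi (0 : ℝ), ENNReal.ofReal (Real.exp (-t) * t ^ (s - 1)) =
      ENNReal.ofReal (Real.Gamma s) := by
  rw [Real.Gamma_eq_integral hs, ofReal_integral_eq_lintegral_ofReal
    (Real.GammaIntegral_convergent hs)]
  filter_upwards [ae_restrict_mem measurableSet_Ioi] with t ht
  have := mem_Ioi.mp ht
  simp only [Pi.zero_apply]
  positivity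

open Module Set in
/-- The integral of `(c‖ξ‖^m + 1)⁻¹` over a normed space of dimension less than `m`. -/
theorem lintegral_inv_mul_norm_pow_add_one {E : Type*} [NormedAddCommGroup E] [NormedSpace ℝ E]
    [FiniteDimensional ℝ E] [Nontrivial E] [MeasurableSpace E] [BorelSpace E] (μ : Measure E)
    [μ.IsAddHaarMeasure] {m : ℕ} (hm : finrank ℝ E < m) {c : ℝ} (hc : 0 < c) :
    ∫⁻ ξ, ENNReal.ofReal ((c * ‖ξ‖ ^ m + 1)⁻¹) ∂μ =
      ENNReal.ofReal (finrank ℝ E * Real.pi / (m * Real.sin (finrank ℝ E * Real.pi / m))) *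
        μ (Metric.ball 0 1) * ENNReal.ofReal (c ^ (-(finrank ℝ E : ℝ) / m)) := by
  have hd : (0 : ℝ) < finrank ℝ E := Nat.cast_pos.mpr finrank_pos
  have hm0 : 0 < m := by lia
  have hm' : (0 : ℝ) < m := Nat.cast_pos.mpr hm0
  have hs : 0 < (1 : ℝ) - finrank ℝ E / m := by
    rw [sub_pos, div_lt_one hm']
    exact_mod_cast hm
  have hG : 0 < Real.Gamma (finrank ℝ E / m + 1) := Real.Gamma_pos_of_pos (by positivity)
  have hΓ : Real.Gamma (finrank ℝ E / m + 1) * Real.Gamma (1 - finrank ℝ E / m) =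
      finrank ℝ E * Real.pi / (m * Real.sin (finrank ℝ E * Real.pi / m)) := by
    rw [Real.Gamma_add_one (by positivity), mul_assoc, Real.Gamma_mul_Gamma_one_sub,
      div_mul_div_comm, mul_div_assoc', mul_comm Real.pi (finrank ℝ E : ℝ)]
  calc
    _ = ∫⁻ ξ, (∫⁻ t in Ioi (0 : ℝ), ENNReal.ofReal (Real.exp (-(c * ‖ξ‖ ^ m + 1) * t))) ∂μ :=
      lintegral_congr fun ξ => (lintegral_exp_neg_mul_Ioi (by positivity)).symm
    _ = ∫⁻ t in Ioi (0 : ℝ), ∫⁻ ξ, ENNReal.ofReal (Real.exp (-(c * ‖ξ‖ ^ m + 1) * t)) ∂μ :=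
      lintegral_lintegral_swap (by simp only [Function.uncurry_def]; fun_prop)
    _ = ∫⁻ t in Ioi (0 : ℝ), ENNReal.ofReal (c ^ (-(finrank ℝ E : ℝ) / m) *
          Real.Gamma (finrank ℝ E / m + 1)) * μ (Metric.ball 0 1) *
        ENNReal.ofReal (Real.exp (-t) * t ^ ((1 - finrank ℝ E / m : ℝ) - 1)) := by
      refine setLIntegral_congr_fun measurableSet_Ioi fun t ht => ?_
      have ht' : 0 < t := ht
      have hsplit (ξ : E) : ENNReal.ofReal (Real.exp (-(c * ‖ξ‖ ^ m + 1) * t)) =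
          ENNReal.ofReal (Real.exp (-t)) * ENNReal.ofReal (Real.exp (-(c * t) * ‖ξ‖ ^ m)) := by
        rw [← ENNReal.ofReal_mul (Real.exp_pos _).le, ← Real.exp_add]
        ring_nf
      simp_rw [hsplit]
      rw [lintegral_const_mul' _ _ ENNReal.ofReal_ne_top,
        lintegral_exp_neg_mul_norm_pow μ hm0 (mul_pos hc ht'), ← mul_assoc,
        ← ENNReal.ofReal_mul (Real.exp_pos _).le, mul_right_comm,
        ← ENNReal.ofReal_mul (by positivity), Real.mul_rpow hc.le ht'.le]
      ring_nf
    _ = _ := by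
      rw [lintegral_const_mul' _ _ (ENNReal.mul_ne_top ENNReal.ofReal_ne_top
        measure_ball_lt_top.ne), lintegral_exp_neg_mul_rpow_Ioi hs, ← hΓ,
        ENNReal.ofReal_mul (by positivity), ENNReal.ofReal_mul hG.le]
      ring

/-- For `n < 2p`, a measurable `Ω ⊆ ℝⁿ`, and a measurable `a` positive on `Ω`,
`∫_Ω ∫_{ℝⁿ} [(a(x)^p‖ξ‖^{2p}+1)⁻¹ + (‖ξ‖^{2p}+1)⁻¹] dξ dx
  = (nπ/(2p·sin(nπ/(2p))))·Vol(B₁)·∫_Ω (a(x)^{-n/2} + 1) dx` in `ℝ≥0∞`. -/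
theorem double_integral_identity (n p : ℕ) (hn : 1 ≤ n) (hnp : n < 2 * p)
    (Ω : Set (EuclideanSpace ℝ (Fin n))) (hΩ : MeasurableSet Ω)
    (a : EuclideanSpace ℝ (Fin n) → ℝ) (hma : Measurable a) (ha : ∀ x ∈ Ω, 0 < a x) :
    (∫⁻ x in Ω, ∫⁻ ξ : EuclideanSpace ℝ (Fin n),
        (ENNReal.ofReal ((a x ^ p * ‖ξ‖ ^ (2 * p) + 1)⁻¹) +
          ENNReal.ofReal ((‖ξ‖ ^ (2 * p) + 1)⁻¹))) =
      ENNReal.ofReal ((n : ℝ) * Real.pi / (2 * p * Real.sin ((n : ℝ) * Real.pi / (2 * p)))) *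
        volume (Metric.ball (0 : EuclideanSpace ℝ (Fin n)) 1) *
        ∫⁻ x in Ω, ENNReal.ofReal (a x ^ (-(n : ℝ) / 2) + 1) := by
  have : Nonempty (Fin n) := ⟨⟨0, hn⟩⟩
  have hp : (p : ℝ) ≠ 0 := Nat.cast_ne_zero.mpr (by lia)
  have hfin : Module.finrank ℝ (EuclideanSpace ℝ (Fin n)) < 2 * p := by simpa using hnp
  rw [← lintegral_const_mul _ (by fun_prop)]
  refine setLIntegral_congr_fun hΩ fun x hx => ?_
  have hax := ha x hx
  have hI := lintegral_inv_mul_norm_pow_add_one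
    (volume : Measure (EuclideanSpace ℝ (Fin n))) hfin (pow_pos hax p)
  have hI₁ := lintegral_inv_mul_norm_pow_add_one
    (volume : Measure (EuclideanSpace ℝ (Fin n))) hfin one_pos
  have hpow : (a x ^ p) ^ (-(n : ℝ) / (2 * p)) = a x ^ (-(n : ℝ) / 2) := by
    rw [← Real.rpow_natCast, ← Real.rpow_mul hax.le]
    congr 1
    field_simp
  simp only [finrank_euclideanSpace_fin, Nat.cast_mul, Nat.cast_ofNat, hpow] at hI
  simp only [finrank_euclideanSpace_fin, Nat.cast_mul, Nat.cast_ofNat, one_mul,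
    Real.one_rpow] at hI₁
  beta_reduce
  rw [lintegral_add_left (by fun_prop), hI, hI₁, ← mul_add,
    ENNReal.ofReal_add (by positivity) zero_le_one]
end
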